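/- arXiv:2307.13190 — 4 statements merged into one kernel-verified Lean document; each statement's English description precedes it below -/
import Mathlib

section
/- Let L ≥ 1, let λ, α ∈ [0,1] with α < 1, and let β : {1,…,L} → ℝ be nondecreasing (β^(1) ≤ … ≤ β^(L)). Let z ∈ ℝ and ν ∈ {1,…,L} be such that β^(ν) = z, β^(l) ≤ z for all l ≤ ν, and β^(l) > z for all l > ν. Then ((1−λ)/L)·Σ_{l=1}^L β^(l) + λ·z + (λ/((1−α)L))·Σ_{l=ν+1}^L (β^(l) − z) = Σ_{l=1}^L w^l · β^(l), where w^l = (1−λ)/L for l < ν, w^ν = (1−λ)/L + λ − λ(L−ν)/((1−α)L), and w^l = (1−λ)/L + λ/((1−α)L) for l > ν. -/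
/-- The CVaR linear objective evaluated at an optimal solution
(where `z` is the Value-at-Risk of the sorted values `β`) equals a weighted
average of the `β l` with the explicit weights `w`. -/
theorem cvar_objective_eq_weighted_sum
    (L : ℕ) (hL : 1 ≤ L) (lam α : ℝ)
    (hlam : lam ∈ Set.Icc (0 : ℝ) 1) (hα : α ∈ Set.Icc (0 : ℝ) 1) (hα1 : α < 1)
    (β : ℕ → ℝ)
    (hmono : ∀ l l', 1 ≤ l → l ≤ l' → l' ≤ L → β l ≤ β l')
    (z : ℝ) (ν : ℕ) (hν : ν ∈ Finset.Icc 1 L)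
    (hzν : β ν = z)
    (hle : ∀ l, 1 ≤ l → l ≤ ν → β l ≤ z)
    (hgt : ∀ l, ν < l → l ≤ L → z < β l)
    (w : ℕ → ℝ)
    (hwlt : ∀ l, 1 ≤ l → l < ν → w l = (1 - lam) / L)
    (hwν : w ν = (1 - lam) / L + lam - lam * ((L : ℝ) - (ν : ℝ)) / ((1 - α) * L))
    (hwgt : ∀ l, ν < l → l ≤ L → w l = (1 - lam) / L + lam / ((1 - α) * L)) :
    ((1 - lam) / L) * ∑ l ∈ Finset.Icc 1 L, β l
      + lam * z
      + (lam / ((1 - α) * L)) * ∑ l ∈ Finset.Icc (ν + 1) L, (β l - z)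
    = ∑ l ∈ Finset.Icc 1 L, w l * β l := by
  obtain ⟨h1, h2⟩ := Finset.mem_Icc.mp hν
  have split : ∀ f : ℕ → ℝ, ∑ l ∈ Finset.Icc 1 L, f l
      = ∑ l ∈ Finset.Ico 1 ν, f l + f ν + ∑ l ∈ Finset.Icc (ν + 1) L, f l := by
    intro f
    have e1 : Finset.Icc 1 L = Finset.Ico 1 (L + 1) := by
      ext x; simp only [Finset.mem_Icc, Finset.mem_Ico]; omega
    have e2 : Finset.Icc (ν + 1) L = Finset.Ico (ν + 1) (L + 1) := by
      ext x; simp only [Finset.mem_Icc, Finset.mem_Ico]; omega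
    rw [e1, e2, ← Finset.sum_Ico_succ_top h1,
      Finset.sum_Ico_consecutive f (by omega) (by omega)]
  have hA : ∑ l ∈ Finset.Ico 1 ν, w l * β l
      = ((1 - lam) / L) * ∑ l ∈ Finset.Ico 1 ν, β l := by
    rw [Finset.mul_sum]
    refine Finset.sum_congr rfl fun l hl => ?_
    rw [Finset.mem_Ico] at hl
    rw [hwlt l hl.1 hl.2]
  have hB : ∑ l ∈ Finset.Icc (ν + 1) L, w l * β l
      = ((1 - lam) / L + lam / ((1 - α) * L)) * ∑ l ∈ Finset.Icc (ν + 1) L, β l := by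
    rw [Finset.mul_sum]
    refine Finset.sum_congr rfl fun l hl => ?_
    rw [Finset.mem_Icc] at hl
    rw [hwgt l (by omega) hl.2]
  have hC : ∑ l ∈ Finset.Icc (ν + 1) L, (β l - z)
      = ∑ l ∈ Finset.Icc (ν + 1) L, β l - ((L : ℝ) - ν) * z := by
    rw [Finset.sum_sub_distrib, Finset.sum_const, Nat.card_Icc, nsmul_eq_mul,
      show L + 1 - (ν + 1) = L - ν by omega, Nat.cast_sub h2]
  rw [split (fun l => w l * β l), split β, hA, hB, hC, hwν, hzν]
  ring
end

section
/- Let L ≥ 1, α ∈ [0,1), and let y : {1,…,L} → ℝ be nondecreasing. Let ν be the smallest index in {1,…,L} with ν ≥ α·L (equivalently, ν = ⌈αL⌉ when αL > 0, and ν = 1 when α = 0). Then the convex function g(b) = b + (1/((1−α)L))·Σ_{l=1}^L max(y^l − b, 0) attains its infimum over b ∈ ℝ at b = y^ν; that is, inf_{b∈ℝ} g(b) = y^ν + (1/((1−α)L))·Σ_{l=1}^L max(y^l − y^ν, 0). -/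
/-- For nondecreasing values `y`, the CVaR auxiliary function
`g(b) = b + (1/((1-α)L)) Σ max(y^l - b, 0)` attains its infimum at the
Value-at-Risk `b = y^ν`, where `ν` is the smallest index in `{1,…,L}` with
`ν ≥ αL`. -/
theorem cvar_inf_attained_at_var
    (L : ℕ) (hL : 1 ≤ L) (α : ℝ) (hα : 0 ≤ α) (hα1 : α < 1)
    (y : ℕ → ℝ)
    (hmono : ∀ l l', 1 ≤ l → l ≤ l' → l' ≤ L → y l ≤ y l')
    (ν : ℕ) (hν : ν ∈ Finset.Icc 1 L)
    (hνge : α * L ≤ (ν : ℝ))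
    (hνmin : ∀ m : ℕ, m ∈ Finset.Icc 1 L → α * L ≤ (m : ℝ) → ν ≤ m) :
    (⨅ b : ℝ, (b + (1 / ((1 - α) * L)) * ∑ l ∈ Finset.Icc 1 L, max (y l - b) 0))
      = y ν + (1 / ((1 - α) * L)) * ∑ l ∈ Finset.Icc 1 L, max (y l - y ν) 0 := by
  obtain ⟨h1, h2⟩ := Finset.mem_Icc.mp hν
  have hLpos : (0 : ℝ) < L := by exact_mod_cast hL
  have hc : 0 < (1 - α) * L := mul_pos (by linarith) hLpos
  have hlow : (ν : ℝ) - 1 ≤ α * L := by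
    by_contra hcon
    push Not at hcon
    have h3 : 2 ≤ ν := by
      by_contra h
      have h4 : ν = 1 := by omega
      subst h4
      have : 0 ≤ α * L := by positivity
      norm_num at hcon
      linarith
    have h5 := hνmin (ν - 1) (Finset.mem_Icc.mpr ⟨by omega, by omega⟩)
      (by rw [Nat.cast_sub h1]; push_cast; linarith)
    omega
  have key : ∀ b : ℝ, (1 - α) * L * (y ν - b) + ∑ l ∈ Finset.Icc 1 L, max (y l - y ν) 0
      ≤ ∑ l ∈ Finset.Icc 1 L, max (y l - b) 0 := by
    intro b
    rcases le_total b (y ν) with hb | hb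
    · have hs : ∑ l ∈ Finset.Icc 1 L, (if ν ≤ l then (y ν - b) else 0)
          = ((L : ℝ) + 1 - ν) * (y ν - b) := by
        rw [← Finset.sum_filter]
        have : (Finset.Icc 1 L).filter (fun l => ν ≤ l) = Finset.Icc ν L := by
          ext l; simp only [Finset.mem_filter, Finset.mem_Icc]; omega
        rw [this, Finset.sum_const, Nat.card_Icc, nsmul_eq_mul, Nat.cast_sub (by omega)]
        push_cast; ring
      have ht : ∑ l ∈ Finset.Icc 1 L, ((if ν ≤ l then (y ν - b) else 0) + max (y l - y ν) 0)
          ≤ ∑ l ∈ Finset.Icc 1 L, max (y l - b) 0 := by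
        apply Finset.sum_le_sum
        intro l hl
        obtain ⟨hl1, hl2⟩ := Finset.mem_Icc.mp hl
        split_ifs with h
        · have := hmono ν l h1 h hl2
          rw [max_eq_left (by linarith), max_eq_left (by linarith)]
          linarith
        · rw [zero_add]
          exact max_le_max (by linarith) le_rfl
      rw [Finset.sum_add_distrib, hs] at ht
      nlinarith [mul_nonneg (sub_nonneg.mpr hlow) (sub_nonneg.mpr hb)]
    · have hs : ∑ l ∈ Finset.Icc 1 L, (if ν < l then (y ν - b) else 0)
          = ((L : ℝ) - ν) * (y ν - b) := by
        rw [← Finset.sum_filter]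
        have : (Finset.Icc 1 L).filter (fun l => ν < l) = Finset.Ioc ν L := by
          ext l; simp only [Finset.mem_filter, Finset.mem_Icc, Finset.mem_Ioc]; omega
        rw [this, Finset.sum_const, Nat.card_Ioc, nsmul_eq_mul, Nat.cast_sub (by omega)]
      have ht : ∑ l ∈ Finset.Icc 1 L, ((if ν < l then (y ν - b) else 0) + max (y l - y ν) 0)
          ≤ ∑ l ∈ Finset.Icc 1 L, max (y l - b) 0 := by
        apply Finset.sum_le_sum
        intro l hl
        obtain ⟨hl1, hl2⟩ := Finset.mem_Icc.mp hl
        split_ifs with h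
        · have := hmono ν l h1 h.le hl2
          rw [max_eq_left (a := y l - y ν) (by linarith)]
          exact le_trans (by linarith) (le_max_left _ _)
        · have := hmono l ν hl1 (by omega) h2
          rw [max_eq_right (a := y l - y ν) (by linarith), zero_add]
          exact le_max_right _ _
      rw [Finset.sum_add_distrib, hs] at ht
      nlinarith [mul_nonneg (sub_nonneg.mpr hνge) (sub_nonneg.mpr hb)]
  have hle : ∀ b : ℝ, y ν + (1 / ((1 - α) * L)) * ∑ l ∈ Finset.Icc 1 L, max (y l - y ν) 0
      ≤ b + (1 / ((1 - α) * L)) * ∑ l ∈ Finset.Icc 1 L, max (y l - b) 0 := by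
    intro b
    have h := mul_le_mul_of_nonneg_left (key b) (one_div_pos.mpr hc).le
    rw [mul_add, ← mul_assoc, one_div_mul_cancel hc.ne', one_mul] at h
    linarith
  apply le_antisymm
  · exact ciInf_le ⟨_, Set.forall_mem_range.mpr hle⟩ (y ν)
  · exact le_ciInf hle
end

section
/- Let L ≥ 1, λ ∈ [0,1], α ∈ [0,1), and let β : {1,…,L} → ℝ be nondecreasing. Let ν be the smallest index in {1,…,L} with ν ≥ α·L, set z = β^ν, and define w^l = (1−λ)/L for l with β^l < z, w^l = (1−λ)/L + λ/((1−α)L) for l with β^l > z, and distribute the remaining weight λ − λ·#{l : β^l > z}/((1−α)L) on (any choice among) the indices with β^l = z so that Σ_l w^l = 1. Then Σ_{l=1}^L w^l · β^l = (1−λ)·(1/L)Σ_{l=1}^L β^l + λ·inf_{b∈ℝ} ( b + (1/((1−α)L))·Σ_{l=1}^L max(β^l − b, 0) ). -/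
lemma sum_indicator_Icc (L n : ℕ) (hn : 1 ≤ n) (hnL : n ≤ L + 1) :
    ∑ l ∈ Finset.Icc 1 L, (if n ≤ l then (1 : ℝ) else 0) = (L : ℝ) + 1 - n := by
  rw [← Finset.sum_filter]
  have : (Finset.Icc 1 L).filter (fun l => n ≤ l) = Finset.Icc n L := by
    ext l; simp only [Finset.mem_filter, Finset.mem_Icc]; omega
  rw [this]
  simp [Nat.cast_sub hnL]

/-- Correctness of the risk-adjusted sampling scheme: the
expectation of the sorted cost-to-go values `β` under the endogenously derived
weights `w` equals the risk measure `(1-λ)·mean(β) + λ·CVaR_α(β)`. -/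
theorem weighted_sum_eq_risk_measure
    (L : ℕ) (hL : 1 ≤ L) (lam α : ℝ)
    (hlam : lam ∈ Set.Icc (0 : ℝ) 1) (hα : 0 ≤ α) (hα1 : α < 1)
    (β : ℕ → ℝ)
    (hmono : ∀ l l', 1 ≤ l → l ≤ l' → l' ≤ L → β l ≤ β l')
    (ν : ℕ) (hν : ν ∈ Finset.Icc 1 L)
    (hνge : α * L ≤ (ν : ℝ))
    (hνmin : ∀ m : ℕ, m ∈ Finset.Icc 1 L → α * L ≤ (m : ℝ) → ν ≤ m)
    (z : ℝ) (hz : z = β ν)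
    (w : ℕ → ℝ)
    (hwlt : ∀ l ∈ Finset.Icc 1 L, β l < z → w l = (1 - lam) / L)
    (hwgt : ∀ l ∈ Finset.Icc 1 L, z < β l →
        w l = (1 - lam) / L + lam / ((1 - α) * L))
    (hwsum : ∑ l ∈ Finset.Icc 1 L, w l = 1) :
    ∑ l ∈ Finset.Icc 1 L, w l * β l
      = (1 - lam) * ((1 / (L : ℝ)) * ∑ l ∈ Finset.Icc 1 L, β l)
        + lam * ⨅ b : ℝ,
            (b + (1 / ((1 - α) * L)) * ∑ l ∈ Finset.Icc 1 L, max (β l - b) 0) := by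
  obtain ⟨hν1, hνL⟩ := Finset.mem_Icc.mp hν
  have hLpos : (0 : ℝ) < L := by exact_mod_cast hL
  have hD : 0 < (1 - α) * L := mul_pos (by linarith) hLpos
  have hc0 : 0 < 1 / ((1 - α) * L) := by positivity
  have hcD : 1 / ((1 - α) * L) * ((1 - α) * L) = 1 := one_div_mul_cancel hD.ne'
  have hdiv : lam / ((1 - α) * L) = lam * (1 / ((1 - α) * L)) := by ring
  rw [hdiv] at hwgt
  generalize 1 / ((1 - α) * L) = c at *
  have hν' : (ν : ℝ) - 1 ≤ α * L := by
    by_contra hcon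
    push Not at hcon
    rcases Nat.eq_or_lt_of_le hν1 with h | h
    · rw [← h] at hcon
      have : 0 ≤ α * L := by positivity
      norm_num at hcon
      linarith
    · have h2 := hνmin (ν - 1) (Finset.mem_Icc.mpr ⟨by omega, by omega⟩)
        (by rw [Nat.cast_sub hν1]; push_cast; linarith)
      omega
  have hmin : ∀ b : ℝ, z + c * ∑ l ∈ Finset.Icc 1 L, max (β l - z) 0
      ≤ b + c * ∑ l ∈ Finset.Icc 1 L, max (β l - b) 0 := by
    intro b
    rcases le_total z b with hb | hb
    · have key : ∑ l ∈ Finset.Icc 1 L, max (β l - z) 0 ≤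
          ∑ l ∈ Finset.Icc 1 L, (max (β l - b) 0 + (b - z) * (if ν + 1 ≤ l then (1 : ℝ) else 0)) := by
        refine Finset.sum_le_sum fun l hl => ?_
        obtain ⟨h1, h2⟩ := Finset.mem_Icc.mp hl
        split_ifs with h
        · apply max_le
          · linarith [le_max_left (β l - b) 0]
          · linarith [le_max_right (β l - b) 0]
        · have := hmono l ν h1 (by omega) hνL
          apply max_le
          · linarith [le_max_right (β l - b) 0]
          · linarith [le_max_right (β l - b) 0]
      rw [Finset.sum_add_distrib, ← Finset.mul_sum, sum_indicator_Icc L (ν + 1) (by omega) (by omega)] at key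
      push_cast at key
      have k1 := mul_le_mul_of_nonneg_left key hc0.le
      have k2 : c * ((L : ℝ) - ν) ≤ 1 := by
        rw [← hcD]
        exact mul_le_mul_of_nonneg_left (by linarith) hc0.le
      have k3 := mul_le_mul_of_nonneg_left k2 (sub_nonneg.mpr hb)
      linarith
    · have key : ∑ l ∈ Finset.Icc 1 L, (max (β l - z) 0 + (z - b) * (if ν ≤ l then (1 : ℝ) else 0)) ≤
          ∑ l ∈ Finset.Icc 1 L, max (β l - b) 0 := by
        refine Finset.sum_le_sum fun l hl => ?_
        obtain ⟨h1, h2⟩ := Finset.mem_Icc.mp hl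
        split_ifs with h
        · have := hmono ν l hν1 h h2
          rw [max_eq_left (by linarith), max_eq_left (by linarith)]
          linarith
        · rw [mul_zero, add_zero]
          exact max_le_max (by linarith) le_rfl
      rw [Finset.sum_add_distrib, ← Finset.mul_sum, sum_indicator_Icc L ν hν1 (by omega)] at key
      have k1 := mul_le_mul_of_nonneg_left key hc0.le
      have k2 : 1 ≤ c * ((L : ℝ) + 1 - ν) := by
        rw [← hcD]
        exact mul_le_mul_of_nonneg_left (by linarith) hc0.le
      have k3 := mul_le_mul_of_nonneg_left k2 (sub_nonneg.mpr hb)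
      linarith
  have hinf : (⨅ b : ℝ, (b + c * ∑ l ∈ Finset.Icc 1 L, max (β l - b) 0))
      = z + c * ∑ l ∈ Finset.Icc 1 L, max (β l - z) 0 := by
    apply le_antisymm
    · exact ciInf_le ⟨_, by rintro _ ⟨b, rfl⟩; exact hmin b⟩ z
    · exact le_ciInf hmin
  rw [hinf]
  have hpt : ∑ l ∈ Finset.Icc 1 L, w l * (β l - z) = ∑ l ∈ Finset.Icc 1 L,
      ((1 - lam) / L * (β l - z) + lam * c * max (β l - z) 0) := by
    refine Finset.sum_congr rfl fun l hl => ?_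
    rcases lt_trichotomy (β l) z with h | h | h
    · rw [hwlt l hl h, max_eq_right (by linarith)]; ring
    · rw [h]; simp
    · rw [hwgt l hl h, max_eq_left (by linarith)]; ring
  rw [Finset.sum_add_distrib, ← Finset.mul_sum, ← Finset.mul_sum, Finset.sum_sub_distrib] at hpt
  simp only [mul_sub, Finset.sum_sub_distrib] at hpt
  rw [← Finset.sum_mul, hwsum] at hpt
  simp only [Finset.sum_const, Nat.card_Icc, Nat.add_sub_cancel, nsmul_eq_mul] at hpt
  have hLL : (1 - lam) / L * (L * z) = (1 - lam) * z := by field_simp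
  rw [hLL] at hpt
  linear_combination hpt
end

section
/- Let L ≥ 1, α ∈ [0,1), and y, y' : {1,…,L} → ℝ. Then inf_{b∈ℝ} ( b + (1/((1−α)L))·Σ_{l=1}^L max((y^l + y'^l) − b, 0) ) ≤ inf_{b∈ℝ} ( b + (1/((1−α)L))·Σ_{l=1}^L max(y^l − b, 0) ) + inf_{b∈ℝ} ( b + (1/((1−α)L))·Σ_{l=1}^L max(y'^l − b, 0) ); that is, the Conditional Value-at-Risk is subadditive. -/
lemma cvar_bddBelow (L : ℕ) (hL : 1 ≤ L) (α : ℝ) (hα : 0 ≤ α) (hα1 : α < 1) (z : ℕ → ℝ) :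
    BddBelow (Set.range fun b : ℝ =>
      b + (1 / ((1 - α) * L)) * ∑ l ∈ Finset.Icc 1 L, max (z l - b) 0) := by
  have hLpos : (0 : ℝ) < L := by exact_mod_cast hL
  have h1 : 0 < 1 - α := by linarith
  set M : ℝ := -∑ l ∈ Finset.Icc 1 L, |z l| with hM
  refine ⟨M, ?_⟩
  rintro _ ⟨b, rfl⟩
  have hz : ∀ l ∈ Finset.Icc 1 L, M ≤ z l := by
    intro l hl
    have h := Finset.single_le_sum (f := fun l => |z l|) (fun i _ => abs_nonneg _) hl
    have h2 := neg_abs_le (z l)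
    linarith
  have hs : (L : ℝ) * max (M - b) 0 ≤ ∑ l ∈ Finset.Icc 1 L, max (z l - b) 0 := by
    have h := Finset.card_nsmul_le_sum (Finset.Icc 1 L) (fun l => max (z l - b) 0)
      (max (M - b) 0) (fun l hl => max_le_max (by linarith [hz l hl]) le_rfl)
    simpa using h
  have hm : max (M - b) 0 ≤ (1 / ((1 - α) * L)) * ∑ l ∈ Finset.Icc 1 L, max (z l - b) 0 := by
    rw [one_div_mul_eq_div, le_div_iff₀ (by positivity)]
    refine le_trans ?_ hs
    have h0 : 0 ≤ α * (L * max (M - b) 0) := by positivity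
    linarith
  have := le_max_left (M - b) 0
  simp only
  linarith

/-- The Conditional Value-at-Risk is subadditive. -/
theorem cvar_subadditive
    (L : ℕ) (hL : 1 ≤ L) (α : ℝ) (hα : 0 ≤ α) (hα1 : α < 1)
    (y y' : ℕ → ℝ) :
    (⨅ b : ℝ, (b + (1 / ((1 - α) * L)) * ∑ l ∈ Finset.Icc 1 L, max ((y l + y' l) - b) 0))
      ≤ (⨅ b : ℝ, (b + (1 / ((1 - α) * L)) * ∑ l ∈ Finset.Icc 1 L, max (y l - b) 0))
        + ⨅ b : ℝ, (b + (1 / ((1 - α) * L)) * ∑ l ∈ Finset.Icc 1 L, max (y' l - b) 0) := by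
  refine le_ciInf_add_ciInf fun b b' => ?_
  refine (ciInf_le (cvar_bddBelow L hL α hα hα1 (fun l => y l + y' l)) (b + b')).trans ?_
  have h1 : 0 < 1 - α := by linarith
  have hs : ∑ l ∈ Finset.Icc 1 L, max ((y l + y' l) - (b + b')) 0
      ≤ ∑ l ∈ Finset.Icc 1 L, max (y l - b) 0 + ∑ l ∈ Finset.Icc 1 L, max (y' l - b') 0 := by
    rw [← Finset.sum_add_distrib]
    refine Finset.sum_le_sum fun l _ => max_le ?_ (by positivity)
    linarith [le_max_left (y l - b) 0, le_max_left (y' l - b') 0]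
  have hc : 0 ≤ 1 / ((1 - α) * (L : ℝ)) := by positivity
  have := mul_le_mul_of_nonneg_left hs hc
  rw [mul_add] at this
  linarith
end
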